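/- Bounds on the discrete layer components: Let 0=x₀<x₁<⋯<x_N=1 be any mesh, define B₂^N(x₀)=1 and B₂^N(x_j)=∏_{i=1}^{j}(1+αh_i/(2ε₂))⁻¹, and suppose the vector mesh function W=(W₁,W₂)ᵀ satisfies (L^N W)(x_j)=0 for 1 ≤ j ≤ N−1, W(x_N)=0, and max{|W₁(x₀)|,|W₂(x₀)|} ≤ C₀. Then there is a constant C (depending only on C₀) such that |W₁(x_j)| ≤ C B₂^N(x_j) and |W₂(x_j)| ≤ C B₂^N(x_j) for 0 ≤ j ≤ N. -/

import Mathlib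

open Set

/-- Forward difference quotient on a mesh. -/
noncomputable def Dp (x U : ℕ → ℝ) (j : ℕ) : ℝ := (U (j+1) - U j) / (x (j+1) - x j)

/-- Backward difference quotient on a mesh. -/
noncomputable def Dm (x U : ℕ → ℝ) (j : ℕ) : ℝ := (U j - U (j-1)) / (x j - x (j-1))

/-- Discrete second-order central difference on a mesh. -/
noncomputable def delta2 (x U : ℕ → ℝ) (j : ℕ) : ℝ :=
  (Dp x U j - Dm x U j) / ((x (j+1) - x (j-1)) / 2)

/-- First component of the discrete operator L^N. -/
noncomputable def LN1 (ε : ℝ) (a b₁₁ b₁₂ : ℝ → ℝ) (x Ψ₁ Ψ₂ : ℕ → ℝ) (j : ℕ) : ℝ :=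
  ε * delta2 x Ψ₁ j + a (x j) * Dp x Ψ₁ j - b₁₁ (x j) * Ψ₁ j + b₁₂ (x j) * Ψ₂ j

/-- Second component of the discrete operator L^N. -/
noncomputable def LN2 (ε : ℝ) (a b₂₂ b₂₁ : ℝ → ℝ) (x Ψ₁ Ψ₂ : ℕ → ℝ) (j : ℕ) : ℝ :=
  ε * delta2 x Ψ₂ j + a (x j) * Dp x Ψ₂ j - b₂₂ (x j) * Ψ₂ j + b₂₁ (x j) * Ψ₁ j

/-- The discrete layer mesh function B₂^N. -/
noncomputable def B2N (α ε₂ : ℝ) (x : ℕ → ℝ) (j : ℕ) : ℝ :=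
  ∏ i ∈ Finset.Icc 1 j, (1 + α * (x i - x (i-1)) / (2 * ε₂))⁻¹

/-- The discrete operator is linear in the pair of mesh functions. -/
theorem LN1_linear_comb (ε : ℝ) (a b₁₁ b₁₂ : ℝ → ℝ) (x U₁ U₂ V₁ V₂ : ℕ → ℝ) (c s : ℝ) (j : ℕ) :
    LN1 ε a b₁₁ b₁₂ x (fun i => c * U₁ i + s * V₁ i) (fun i => c * U₂ i + s * V₂ i) j =
      c * LN1 ε a b₁₁ b₁₂ x U₁ U₂ j + s * LN1 ε a b₁₁ b₁₂ x V₁ V₂ j := by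
  simp only [LN1, delta2, Dp, Dm]
  ring

/-- At a negative interior minimum of the smaller component, the operator is positive. -/
theorem LN1_pos_of_neg_min {ε : ℝ} {a b₁₁ b₁₂ : ℝ → ℝ} {x P Q : ℕ → ℝ} {k : ℕ}
    (hε : 0 < ε) (hx₁ : x k < x (k + 1)) (hx₂ : x (k + 1) < x (k + 2))
    (ha : 0 ≤ a (x (k + 1))) (hb : 0 < b₁₁ (x (k + 1)) - b₁₂ (x (k + 1)))
    (hb' : 0 ≤ b₁₂ (x (k + 1))) (hl : P (k + 1) ≤ P k) (hr : P (k + 1) ≤ P (k + 2))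
    (hPQ : P (k + 1) ≤ Q (k + 1)) (hneg : P (k + 1) < 0) :
    0 < LN1 ε a b₁₁ b₁₂ x P Q (k + 1) := by
  have hp : 0 ≤ Dp x P (k + 1) := div_nonneg (sub_nonneg.2 hr) (sub_nonneg.2 hx₂.le)
  have hm : Dm x P (k + 1) ≤ 0 :=
    div_nonpos_of_nonpos_of_nonneg (sub_nonpos.2 hl) (sub_nonneg.2 hx₁.le)
  have hd : 0 ≤ delta2 x P (k + 1) := by
    refine div_nonneg (by linarith) ?_
    simp only [Nat.add_sub_cancel, add_assoc, Nat.reduceAdd]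
    linarith
  have h₁ := mul_nonneg hε.le hd
  have h₂ := mul_nonneg ha hp
  have h₃ := mul_le_mul_of_nonneg_left hPQ hb'
  have h₄ := mul_pos hb (neg_pos.2 hneg)
  unfold LN1
  linarith

theorem mesh_mem_Icc {N : ℕ} {x : ℕ → ℝ} (h0 : x 0 = 0) (hN : x N = 1)
    (hx : ∀ j < N, x j < x (j + 1)) {j : ℕ} (hj : j ≤ N) : x j ∈ Icc (0 : ℝ) 1 := by
  have hmono : ∀ i k, i + k ≤ N → x i ≤ x (i + k) := by
    intro i k
    induction k with
    | zero => simp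
    | succ k ih => exact fun h => (ih (by omega)).trans (hx (i + k) (by omega)).le
  constructor
  · simpa [h0] using hmono 0 j (by omega)
  · simpa [Nat.add_sub_cancel' hj, hN] using hmono j (N - j) (by omega)

/-- Discrete minimum principle for the coupled system. -/
theorem discrete_minimum_principle {ε₁ ε₂ : ℝ} {a₁ a₂ b₁₁ b₁₂ b₂₁ b₂₂ : ℝ → ℝ}
    (hε₁ : 0 < ε₁) (hε₂ : 0 < ε₂)
    (ha₁ : ∀ x ∈ Icc (0:ℝ) 1, 0 ≤ a₁ x) (ha₂ : ∀ x ∈ Icc (0:ℝ) 1, 0 ≤ a₂ x)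
    (hb₁ : ∀ x ∈ Icc (0:ℝ) 1, 0 < b₁₁ x - b₁₂ x) (hb₂ : ∀ x ∈ Icc (0:ℝ) 1, 0 < b₂₂ x - b₂₁ x)
    (hb₁₂ : ∀ x ∈ Icc (0:ℝ) 1, 0 ≤ b₁₂ x) (hb₂₁ : ∀ x ∈ Icc (0:ℝ) 1, 0 ≤ b₂₁ x)
    {N : ℕ} {x : ℕ → ℝ} (h0 : x 0 = 0) (hN : x N = 1) (hx : ∀ j < N, x j < x (j + 1))
    {P Q : ℕ → ℝ}
    (hP : ∀ j, 1 ≤ j → j < N → LN1 ε₁ a₁ b₁₁ b₁₂ x P Q j ≤ 0)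
    (hQ : ∀ j, 1 ≤ j → j < N → LN2 ε₂ a₂ b₂₂ b₂₁ x P Q j ≤ 0)
    (hP0 : 0 ≤ P 0) (hQ0 : 0 ≤ Q 0) (hPN : 0 ≤ P N) (hQN : 0 ≤ Q N) :
    ∀ j ≤ N, 0 ≤ P j ∧ 0 ≤ Q j := by
  obtain ⟨m, hm, hmin⟩ := Finset.exists_min_image (Finset.range (N + 1))
    (fun j => min (P j) (Q j)) ⟨0, by simp⟩
  have hmin' : ∀ j ≤ N, min (P m) (Q m) ≤ P j ∧ min (P m) (Q m) ≤ Q j := fun j hj =>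
    le_min_iff.1 (hmin j (Finset.mem_range.2 (by omega)))
  suffices h : 0 ≤ min (P m) (Q m) from
    fun j hj => ⟨h.trans (hmin' j hj).1, h.trans (hmin' j hj).2⟩
  by_contra! hneg
  have hmN : m ≤ N := by simpa [Nat.lt_succ_iff] using hm
  have hne : m ≠ N := by
    rintro rfl
    exact hneg.not_ge (le_min hPN hQN)
  obtain _ | k := m
  · exact hneg.not_ge (le_min hP0 hQ0)
  have hmem := mesh_mem_Icc h0 hN hx hmN
  have hx₁ := hx k (by omega)
  have hx₂ := hx (k + 1) (by omega)
  have hl := hmin' k (by omega)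
  have hr := hmin' (k + 2) (by omega)
  rcases le_total (P (k + 1)) (Q (k + 1)) with h | h
  · rw [min_eq_left h] at hneg hl hr
    exact (LN1_pos_of_neg_min hε₁ hx₁ hx₂ (ha₁ _ hmem) (hb₁ _ hmem) (hb₁₂ _ hmem)
      hl.1 hr.1 h hneg).not_ge (hP _ (by omega) (by omega))
  · rw [min_eq_right h] at hneg hl hr
    exact (LN1_pos_of_neg_min hε₂ hx₁ hx₂ (ha₂ _ hmem) (hb₂ _ hmem) (hb₂₁ _ hmem)
      hl.2 hr.2 h hneg).not_ge (hQ _ (by omega) (by omega))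

theorem B2N_zero (α ε₂ : ℝ) (x : ℕ → ℝ) : B2N α ε₂ x 0 = 1 := by
  simp [B2N]

theorem B2N_succ (α ε₂ : ℝ) (x : ℕ → ℝ) (j : ℕ) :
    B2N α ε₂ x (j + 1) = B2N α ε₂ x j * (1 + α * (x (j + 1) - x j) / (2 * ε₂))⁻¹ := by
  simp [B2N, Finset.prod_Icc_succ_top, mul_comm]

theorem B2N_pos {α ε₂ : ℝ} (hα : 0 < α) (hε₂ : 0 < ε₂) {N : ℕ} {x : ℕ → ℝ}
    (hx : ∀ j < N, x j < x (j + 1)) : ∀ j ≤ N, 0 < B2N α ε₂ x j := by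
  intro j
  induction j with
  | zero => simp [B2N_zero]
  | succ j ih =>
    intro hj
    have := sub_pos.2 (hx j (by omega))
    have := ih (by omega)
    rw [B2N_succ]
    positivity

theorem B2N_sub_succ {α ε₂ : ℝ} (hα : 0 < α) (hε₂ : 0 < ε₂) {x : ℕ → ℝ} {j : ℕ}
    (hx : x j < x (j + 1)) :
    (B2N α ε₂ x (j + 1) - B2N α ε₂ x j) / (x (j + 1) - x j) =
      -(α / (2 * ε₂)) * B2N α ε₂ x (j + 1) := by
  have h := sub_pos.2 hx
  have h' : 0 < 1 + α * (x (j + 1) - x j) / (2 * ε₂) := by positivity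
  have hB : B2N α ε₂ x j =
      B2N α ε₂ x (j + 1) * (1 + α * (x (j + 1) - x j) / (2 * ε₂)) := by
    rw [B2N_succ, inv_mul_cancel_right₀ h'.ne']
  rw [div_eq_iff h.ne', hB]
  ring

/-- The layer mesh function is a supersolution of each equation of the system. -/
theorem LN1_B2N_nonpos {ε ε₂ α : ℝ} {a b₁₁ b₁₂ : ℝ → ℝ} {N : ℕ} {x : ℕ → ℝ}
    (hε : 0 ≤ ε) (hεε₂ : ε ≤ ε₂) (hε₂ : 0 < ε₂) (hα : 0 < α)
    (hx : ∀ j < N, x j < x (j + 1)) {j : ℕ} (hj : 1 ≤ j) (hjN : j < N)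
    (ha : α ≤ a (x j)) (hb : 0 ≤ b₁₁ (x j) - b₁₂ (x j)) :
    LN1 ε a b₁₁ b₁₂ x (B2N α ε₂ x) (B2N α ε₂ x) j ≤ 0 := by
  obtain ⟨k, rfl⟩ : ∃ k, j = k + 1 := ⟨j - 1, by omega⟩
  have h₁ := hx k (by omega)
  have h₂ := hx (k + 1) hjN
  have hB₁ := B2N_pos hα hε₂ hx (k + 1) hjN.le
  have hB₂ := B2N_pos hα hε₂ hx (k + 2) hjN
  have hp : Dp x (B2N α ε₂ x) (k + 1) = -(α / (2 * ε₂)) * B2N α ε₂ x (k + 2) :=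
    B2N_sub_succ hα hε₂ h₂
  have hm : Dm x (B2N α ε₂ x) (k + 1) = -(α / (2 * ε₂)) * B2N α ε₂ x (k + 1) :=
    B2N_sub_succ hα hε₂ h₁
  have hdiff : B2N α ε₂ x (k + 1) - B2N α ε₂ x (k + 2) =
      α / (2 * ε₂) * B2N α ε₂ x (k + 2) * (x (k + 2) - x (k + 1)) := by
    have := (div_eq_iff (sub_pos.2 h₂).ne').1 (B2N_sub_succ hα hε₂ h₂)
    linarith
  have hd : delta2 x (B2N α ε₂ x) (k + 1) ≤
      2 * (α / (2 * ε₂)) ^ 2 * B2N α ε₂ x (k + 2) := by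
    unfold delta2
    rw [hp, hm]
    simp only [Nat.add_sub_cancel, add_assoc, Nat.reduceAdd]
    rw [div_le_iff₀ (by linarith)]
    have h : 0 ≤ (α / (2 * ε₂)) ^ 2 * B2N α ε₂ x (k + 2) * (x (k + 1) - x k) :=
      mul_nonneg (by positivity) (sub_nonneg.2 h₁.le)
    linear_combination (α / (2 * ε₂)) * hdiff + h
  have hc : 0 ≤ α / (2 * ε₂) * B2N α ε₂ x (k + 2) := by positivity
  have h₃ := mul_le_mul_of_nonneg_left hd hε
  have h₄ := mul_le_mul_of_nonneg_right ha hc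
  have h₅ : ε * (α / ε₂) ≤ α := by
    rw [← mul_div_assoc, div_le_iff₀ hε₂, mul_comm α]
    exact mul_le_mul_of_nonneg_right hεε₂ hα.le
  have h₆ := mul_le_mul_of_nonneg_right h₅ hc
  have h₇ := mul_nonneg hb hB₁.le
  unfold LN1
  rw [hp]
  linear_combination h₃ + h₄ + h₆ + h₇

/-- Bounds on the discrete layer components in terms of the layer mesh function
B₂^N, with a constant depending only on C₀. -/
theorem discrete_layer_bounds (C₀ : ℝ) (hC₀ : 0 ≤ C₀) :
    ∃ C : ℝ, 0 < C ∧
      ∀ (ε₁ ε₂ α β : ℝ) (a₁ a₂ b₁₁ b₁₂ b₂₁ b₂₂ : ℝ → ℝ),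
        0 < ε₁ → ε₁ < ε₂ → 0 < α → 0 < β →
        (∀ x ∈ Icc (0:ℝ) 1, α ≤ a₁ x) → (∀ x ∈ Icc (0:ℝ) 1, α ≤ a₂ x) →
        (∀ x ∈ Icc (0:ℝ) 1, β ≤ b₁₁ x - b₁₂ x) →
        (∀ x ∈ Icc (0:ℝ) 1, β ≤ b₂₂ x - b₂₁ x) →
        (∀ x ∈ Icc (0:ℝ) 1, 0 < b₁₂ x) → (∀ x ∈ Icc (0:ℝ) 1, 0 < b₂₁ x) →
        ∀ (N : ℕ), 1 ≤ N → ∀ x : ℕ → ℝ,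
          x 0 = 0 → x N = 1 → (∀ j < N, x j < x (j+1)) →
          ∀ W₁ W₂ : ℕ → ℝ,
            (∀ j, 1 ≤ j → j < N →
              LN1 ε₁ a₁ b₁₁ b₁₂ x W₁ W₂ j = 0 ∧ LN2 ε₂ a₂ b₂₂ b₂₁ x W₁ W₂ j = 0) →
            W₁ N = 0 → W₂ N = 0 → max |W₁ 0| |W₂ 0| ≤ C₀ →
            ∀ j ≤ N, |W₁ j| ≤ C * B2N α ε₂ x j ∧ |W₂ j| ≤ C * B2N α ε₂ x j := by
  refine ⟨C₀ + 1, by linarith, ?_⟩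
  intro ε₁ ε₂ α β a₁ a₂ b₁₁ b₁₂ b₂₁ b₂₂ hε₁ hε hα hβ ha₁ ha₂ hb₁ hb₂ hb₁₂ hb₂₁
    N _ x h0 hN hx W₁ W₂ hW hW₁ hW₂ hmax
  obtain ⟨hm₁, hm₂⟩ := max_le_iff.1 hmax
  have hε₂ := hε₁.trans hε
  have barrier : ∀ s : ℝ, |s| = 1 → ∀ j ≤ N,
      0 ≤ (C₀ + 1) * B2N α ε₂ x j + s * W₁ j ∧ 0 ≤ (C₀ + 1) * B2N α ε₂ x j + s * W₂ j := by
    intro s hs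
    have hBN := B2N_pos hα hε₂ hx N le_rfl
    have hbdry : ∀ w : ℝ, |w| ≤ C₀ → 0 ≤ (C₀ + 1) * B2N α ε₂ x 0 + s * w := by
      intro w hw
      have h := neg_abs_le (s * w)
      rw [abs_mul, hs, one_mul] at h
      rw [B2N_zero]
      linarith
    refine discrete_minimum_principle hε₁ hε₂ (fun y hy => hα.le.trans (ha₁ y hy))
      (fun y hy => hα.le.trans (ha₂ y hy)) (fun y hy => hβ.trans_le (hb₁ y hy))
      (fun y hy => hβ.trans_le (hb₂ y hy)) (fun y hy => (hb₁₂ y hy).le)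
      (fun y hy => (hb₂₁ y hy).le) h0 hN hx
      (P := fun i => (C₀ + 1) * B2N α ε₂ x i + s * W₁ i)
      (Q := fun i => (C₀ + 1) * B2N α ε₂ x i + s * W₂ i)
      ?_ ?_ (hbdry _ hm₁) (hbdry _ hm₂) ?_ ?_
    · intro j hj hjN
      have hmem := mesh_mem_Icc h0 hN hx hjN.le
      rw [LN1_linear_comb, (hW j hj hjN).1, mul_zero, add_zero]
      exact mul_nonpos_of_nonneg_of_nonpos (by linarith)
        (LN1_B2N_nonpos hε₁.le hε.le hε₂ hα hx hj hjN (ha₁ _ hmem) (hβ.le.trans (hb₁ _ hmem)))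
    · intro j hj hjN
      have hmem := mesh_mem_Icc h0 hN hx hjN.le
      have hW' : LN1 ε₂ a₂ b₂₂ b₂₁ x W₂ W₁ j = 0 := (hW j hj hjN).2
      change LN1 ε₂ a₂ b₂₂ b₂₁ x (fun i => (C₀ + 1) * B2N α ε₂ x i + s * W₂ i)
        (fun i => (C₀ + 1) * B2N α ε₂ x i + s * W₁ i) j ≤ 0
      rw [LN1_linear_comb, hW', mul_zero, add_zero]
      exact mul_nonpos_of_nonneg_of_nonpos (by linarith)
        (LN1_B2N_nonpos hε₂.le le_rfl hε₂ hα hx hj hjN (ha₂ _ hmem) (hβ.le.trans (hb₂ _ hmem)))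
    · simp only [hW₁, mul_zero, add_zero]
      positivity
    · simp only [hW₂, mul_zero, add_zero]
      positivity
  intro j hj
  have hpos := barrier 1 (by simp) j hj
  have hneg := barrier (-1) (by simp) j hj
  constructor <;> rw [abs_le] <;> constructor <;> linarith [hpos.1, hpos.2, hneg.1, hneg.2]
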